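/- Suppose there exists an automorphism f of the weighted graph (G,a) with f(v₀) = v₁ and f(v₁) = v₀. Then for every e₀ ∈ E, the measures ℙ_{v₀,v₁,e₀} and ℚ_{v₀,e₀} are mutually absolutely continuous with Radon–Nikodym derivative dℙ_{v₀,v₁,e₀}/dℚ_{v₀,e₀} = Z_{v₀,v₁,e₀}^{−1}·(x_{v₁}/x_{v₀})^{1/4}. As a consequence, Z_{v₀,v₁,e₀} = E_{ℚ_{v₀,e₀}}[ (x_{v₁}/x_{v₀})^{1/4} ] (in particular this expectation is finite). -/

import Mathlib

open MeasureTheory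
open scoped ENNReal Classical

namespace ERRWGraph

noncomputable section

variable {V : Type*} [Fintype V] [DecidableEq V]

/-- The measure `dx/x` on `(0,∞)`, i.e. Lebesgue measure on a logarithmic scale. -/
def logMeasure : Measure ℝ :=
  (volume.restrict (Set.Ioi (0 : ℝ))).withDensity fun x => ENNReal.ofReal (1 / x)

variable (G : SimpleGraph V) [Fintype G.edgeSet]

/-- The set `Ω_{e₀}` of strictly positive edge weights normalized at the reference
edge `e₀`. -/
def Omega (e₀ : G.edgeSet) : Set (G.edgeSet → ℝ) :=
  {x | (∀ e, 0 < x e) ∧ x e₀ = 1}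

/-- The reference measure `ρ_{e₀} = δ₁(dx_{e₀}) ∏_{e ≠ e₀} dx_e/x_e`, realized as a
measure on `(0,∞)^E ⊆ ℝ^E` concentrated on `Ω_{e₀}`. -/
def rho (e₀ : G.edgeSet) : Measure (G.edgeSet → ℝ) :=
  Measure.pi fun e => if e = e₀ then Measure.dirac 1 else logMeasure

/-- Vertex weight `x_v = ∑_{e ∋ v} x_e`. -/
def vwt (x : G.edgeSet → ℝ) (v : V) : ℝ :=
  ∑ e : G.edgeSet, if v ∈ (e : Sym2 V) then x e else 0

/-- Vertex weight `a_v = ∑_{e ∋ v} a_e` of the initial weights `a : Sym2 V → ℝ`. -/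
def avwt (a : Sym2 V → ℝ) (v : V) : ℝ :=
  ∑ e : G.edgeSet, if v ∈ (e : Sym2 V) then a (e : Sym2 V) else 0

/-- A set `T` of edges of `G` is a spanning tree iff the graph with edge set `T`
is a tree (i.e. a maximal connected acyclic subgraph of `G`). -/
def IsSpanningTree (T : Finset G.edgeSet) : Prop :=
  (SimpleGraph.fromEdgeSet (Subtype.val '' (T : Set G.edgeSet))).IsTree

/-- `∑_{T ∈ 𝒯} ∏_{e ∈ T} x_e`, the sum over spanning trees of `G`. -/
def treeSum (x : G.edgeSet → ℝ) : ℝ :=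
  ∑ T : Finset G.edgeSet, if IsSpanningTree G T then (∏ e ∈ T, x e) else 0

/-- The function `Φ_{v₀,a}` from the Coppersmith–Diaconis description of the
mixing measure. -/
def Phi (a : Sym2 V → ℝ) (v₀ : V) (x : G.edgeSet → ℝ) : ℝ :=
  (∏ e : G.edgeSet, x e ^ a (e : Sym2 V)) * vwt G x v₀ ^ (-avwt G a v₀ / 2) *
    (∏ v ∈ Finset.univ.erase v₀, vwt G x v ^ (-(avwt G a v + 1) / 2)) *
    Real.sqrt (treeSum G x)

/-- The normalizing constant `z_{v₀,e₀} = ∫ Φ_{v₀,a} dρ_{e₀}`. -/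
def z (a : Sym2 V → ℝ) (v₀ : V) (e₀ : G.edgeSet) : ℝ≥0∞ :=
  ∫⁻ x, ENNReal.ofReal (Phi G a v₀ x) ∂rho G e₀

/-- The mixing measure `ℚ_{v₀,e₀}`, with density `Φ_{v₀,a}/z_{v₀,e₀}` w.r.t. `ρ_{e₀}`. -/
def Qm (a : Sym2 V → ℝ) (v₀ : V) (e₀ : G.edgeSet) : Measure (G.edgeSet → ℝ) :=
  (z G a v₀ e₀)⁻¹ • (rho G e₀).withDensity fun x => ENNReal.ofReal (Phi G a v₀ x)

/-- The density `((Φ_{v₀,a}/z_{v₀,e₀})·(Φ_{v₁,a}/z_{v₁,e₀}))^{1/2}` of the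
interpolated measure. -/
def interpDens (a : Sym2 V → ℝ) (v₀ v₁ : V) (e₀ : G.edgeSet) (x : G.edgeSet → ℝ) : ℝ≥0∞ :=
  (ENNReal.ofReal (Phi G a v₀ x) / z G a v₀ e₀ *
    (ENNReal.ofReal (Phi G a v₁ x) / z G a v₁ e₀)) ^ (1 / 2 : ℝ)

/-- The normalizing constant `Z_{v₀,v₁,e₀}` of the interpolated measure. -/
def Zc (a : Sym2 V → ℝ) (v₀ v₁ : V) (e₀ : G.edgeSet) : ℝ≥0∞ :=
  ∫⁻ x, interpDens G a v₀ v₁ e₀ x ∂rho G e₀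

/-- The interpolated measure `ℙ_{v₀,v₁,e₀}`. -/
def Pm (a : Sym2 V → ℝ) (v₀ v₁ : V) (e₀ : G.edgeSet) : Measure (G.edgeSet → ℝ) :=
  (Zc G a v₀ v₁ e₀)⁻¹ • (rho G e₀).withDensity (interpDens G a v₀ v₁ e₀)

/-- `f` is an automorphism of the weighted graph `(G,a)`. -/
def IsAut (a : Sym2 V → ℝ) (f : V → V) : Prop :=
  Function.Bijective f ∧ (∀ u v : V, G.Adj (f u) (f v) ↔ G.Adj u v) ∧
    ∀ u v : V, G.Adj u v → a s(f u, f v) = a s(u, v)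

/-- Assumption 2.3 of the paper. -/
def Assumption23 (a φ : Sym2 V → ℝ) (v₀ v₁ : V) (e₀ : G.edgeSet) : Prop :=
  v₀ ≠ v₁ ∧ ¬G.Adj v₀ v₁ ∧ v₀ ∈ (e₀ : Sym2 V) ∧
    (∃ f : V → V, IsAut G a f ∧ f v₀ = v₁ ∧ f v₁ = v₀) ∧
    (∀ e : G.edgeSet, φ (e : Sym2 V) ∈ Set.Icc (0 : ℝ) 1) ∧
    (∀ e : G.edgeSet, v₀ ∈ (e : Sym2 V) → φ (e : Sym2 V) = 0) ∧
    (∀ e : G.edgeSet, v₁ ∈ (e : Sym2 V) → φ (e : Sym2 V) = 1)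

/-- `max_{e,e' ∋ v} (φ(e) - φ(e'))²`. -/
def maxsq (φ : Sym2 V → ℝ) (v : V) : ℝ :=
  sSup ((fun p : G.edgeSet × G.edgeSet =>
      (φ (p.1 : Sym2 V) - φ (p.2 : Sym2 V)) ^ 2) ''
    {p : G.edgeSet × G.edgeSet | v ∈ (p.1 : Sym2 V) ∧ v ∈ (p.2 : Sym2 V)})

/-- The "Dirichlet form" `S_φ`. -/
def Sphi (a φ : Sym2 V → ℝ) : ℝ :=
  ∑ v : V, (avwt G a v + 1) / 2 * maxsq G φ v

/-- `H_{v₀,v₁}(x) = (1/4) log (x_{v₁}/x_{v₀})`. -/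
def Hfun (v₀ v₁ : V) (x : G.edgeSet → ℝ) : ℝ :=
  (1 / 4) * Real.log (vwt G x v₁ / vwt G x v₀)

/-- `log (dQ/dP)` realized via the Radon–Nikodym derivative. -/
def logRN {α : Type*} [MeasurableSpace α] (Q P : Measure α) (x : α) : ℝ :=
  Real.log ((Q.rnDeriv P x).toReal)

/-- The deformation map `Ξ^{γφ}(x) = (e^{γφ(e)} x_e)_{e∈E}`. -/
def Xi (φ : Sym2 V → ℝ) (γ : ℝ) (x : G.edgeSet → ℝ) : G.edgeSet → ℝ :=
  fun e => Real.exp (γ * φ (e : Sym2 V)) * x e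

/-- `Π^{γφ}`, the image of `ℙ_{v₀,v₁,e₀}` under `Ξ^{γφ}`. -/
def PiGamma (a φ : Sym2 V → ℝ) (v₀ v₁ : V) (e₀ : G.edgeSet) (γ : ℝ) :
    Measure (G.edgeSet → ℝ) :=
  Measure.map (Xi G φ γ) (Pm G a v₀ v₁ e₀)

/-- The explicit realization `f_γ` of `log(dΠ^{γφ}/dℙ_{v₀,v₁,e₀}) ∘ Ξ^{γφ}`. -/
def fgamma (a φ : Sym2 V → ℝ) (v₀ v₁ : V) (γ : ℝ) (x : G.edgeSet → ℝ) : ℝ :=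
  γ * (avwt G a v₁ / 2 + 1 / 4) -
    γ * ∑ e : G.edgeSet, φ (e : Sym2 V) * a (e : Sym2 V) +
    (∑ v ∈ Finset.univ \ {v₀, v₁}, (avwt G a v + 1) / 2 *
      Real.log (vwt G (Xi G φ γ x) v / vwt G x v)) -
    (1 / 2) * Real.log (treeSum G (Xi G φ γ x) / treeSum G x)

/-- Mean of `φ` under the measure `μ_{x,v,γ}` on the edges incident to `v`. -/
def muMean (φ : Sym2 V → ℝ) (γ : ℝ) (x : G.edgeSet → ℝ) (v : V) : ℝ :=
  (∑ e : G.edgeSet, if v ∈ (e : Sym2 V) then φ (e : Sym2 V) * Xi G φ γ x e else 0) /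
    vwt G (Xi G φ γ x) v

/-- Variance of `φ` under `μ_{x,v,γ}`. -/
def muVar (φ : Sym2 V → ℝ) (γ : ℝ) (x : G.edgeSet → ℝ) (v : V) : ℝ :=
  (∑ e : G.edgeSet, if v ∈ (e : Sym2 V) then
      (φ (e : Sym2 V) - muMean G φ γ x v) ^ 2 * Xi G φ γ x e else 0) /
    vwt G (Xi G φ γ x) v

/-- `Δ(T) = ∑_{e ∈ T} φ(e)`. -/
def Delta (φ : Sym2 V → ℝ) (T : Finset G.edgeSet) : ℝ := ∑ e ∈ T, φ (e : Sym2 V)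

/-- Mean of `Δ` under the measure `ν_{x,γ}` on spanning trees. -/
def nuMean (φ : Sym2 V → ℝ) (γ : ℝ) (x : G.edgeSet → ℝ) : ℝ :=
  (∑ T : Finset G.edgeSet, if IsSpanningTree G T then
      Delta G φ T * ∏ e ∈ T, Xi G φ γ x e else 0) /
    treeSum G (Xi G φ γ x)

/-- Variance of `Δ` under `ν_{x,γ}`. -/
def nuVar (φ : Sym2 V → ℝ) (γ : ℝ) (x : G.edgeSet → ℝ) : ℝ :=
  (∑ T : Finset G.edgeSet, if IsSpanningTree G T then
      (Delta G φ T - nuMean G φ γ x) ^ 2 * ∏ e ∈ T, Xi G φ γ x e else 0) /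
    treeSum G (Xi G φ γ x)

/-- The claimed first derivative of `γ ↦ f_γ(x)`. -/
def fder1 (a φ : Sym2 V → ℝ) (v₀ v₁ : V) (x : G.edgeSet → ℝ) (γ : ℝ) : ℝ :=
  avwt G a v₁ / 2 + 1 / 4 - (∑ e : G.edgeSet, φ (e : Sym2 V) * a (e : Sym2 V)) +
    (∑ v ∈ Finset.univ \ {v₀, v₁}, (avwt G a v + 1) / 2 * muMean G φ γ x v) -
    (1 / 2) * nuMean G φ γ x

/-- The claimed second derivative of `γ ↦ f_γ(x)`. -/
def fder2 (a φ : Sym2 V → ℝ) (v₀ v₁ : V) (x : G.edgeSet → ℝ) (γ : ℝ) : ℝ :=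
  (∑ v ∈ Finset.univ \ {v₀, v₁}, (avwt G a v + 1) / 2 * muVar G φ γ x v) -
    (1 / 2) * nuVar G φ γ x

/-- Membership in the class `𝒫` of the variational principle. -/
def VarP (a : Sym2 V → ℝ) (v₀ v₁ : V) (e₀ : G.edgeSet)
    (Q : Measure (G.edgeSet → ℝ)) : Prop :=
  IsProbabilityMeasure Q ∧ Q ≪ Pm G a v₀ v₁ e₀ ∧ Pm G a v₀ v₁ e₀ ≪ Q ∧
    Integrable (Hfun G v₀ v₁) Q ∧ Integrable (logRN Q (Pm G a v₀ v₁ e₀)) Q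

/-- The functional `F(Π) = E_Π[H] + E_Π[log(dΠ/dℙ_{v₀,v₁,e₀})]`. -/
def Ffun (a : Sym2 V → ℝ) (v₀ v₁ : V) (e₀ : G.edgeSet)
    (Q : Measure (G.edgeSet → ℝ)) : ℝ :=
  (∫ x, Hfun G v₀ v₁ x ∂Q) + ∫ x, logRN Q (Pm G a v₀ v₁ e₀) x ∂Q

end

end ERRWGraph

namespace ERRWGraph

section LogMeasure

lemma logMeasure_eq_map_exp : logMeasure = (volume : Measure ℝ).map Real.exp := by
  refine Measure.ext_of_lintegral _ fun g hg => ?_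
  have h := lintegral_image_eq_lintegral_abs_deriv_mul (s := Set.univ) (f := Real.exp)
    (f' := Real.exp) MeasurableSet.univ (fun x _ => (Real.hasDerivAt_exp x).hasDerivWithinAt)
    Real.exp_injective.injOn (fun x => ENNReal.ofReal (1 / x) * g x)
  rw [Set.image_univ, Real.range_exp, Measure.restrict_univ] at h
  rw [lintegral_map hg Real.measurable_exp, logMeasure,
    lintegral_withDensity_eq_lintegral_mul _ (by fun_prop) hg]
  refine h.trans (lintegral_congr fun x => ?_)
  rw [← mul_assoc, ← ENNReal.ofReal_mul (abs_nonneg _), abs_of_pos (Real.exp_pos x),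
    mul_one_div_cancel (Real.exp_pos x).ne', ENNReal.ofReal_one, one_mul]

instance : SigmaFinite logMeasure := by
  unfold logMeasure
  infer_instance

lemma ae_logMeasure_pos : ∀ᵐ t ∂logMeasure, 0 < t := by
  rw [logMeasure_eq_map_exp]
  exact (ae_map_iff Real.measurable_exp.aemeasurable measurableSet_Ioi).2
    (Filter.Eventually.of_forall Real.exp_pos)

lemma measurePreserving_mul_logMeasure {t : ℝ} (ht : 0 < t) :
    MeasurePreserving (fun x => t * x) logMeasure logMeasure := by
  refine ⟨by fun_prop, ?_⟩
  rw [logMeasure_eq_map_exp, Measure.map_map (by fun_prop) Real.measurable_exp]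
  have h : (fun x => t * x) ∘ Real.exp = Real.exp ∘ fun x => Real.log t + x := by
    ext x
    simp [Real.exp_add, Real.exp_log ht]
  rw [h, ← Measure.map_map Real.measurable_exp (by fun_prop), map_add_left_eq_self]

lemma measurePreserving_inv_logMeasure :
    MeasurePreserving (fun x : ℝ => x⁻¹) logMeasure logMeasure := by
  refine ⟨measurable_inv, ?_⟩
  rw [logMeasure_eq_map_exp, Measure.map_map measurable_inv Real.measurable_exp]
  have h : (fun x : ℝ => x⁻¹) ∘ Real.exp = Real.exp ∘ fun x => -x := by
    ext x
    simp [Real.exp_neg]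
  rw [h, ← Measure.map_map Real.measurable_exp measurable_neg,
    (Measure.measurePreserving_neg (volume : Measure ℝ)).map_eq]

/-- The factors of the reference measure normalized at `i`. -/
noncomputable def refFactor {ι : Type*} [DecidableEq ι] (i j : ι) : Measure ℝ :=
  if j = i then Measure.dirac 1 else logMeasure

variable {ι : Type*} [DecidableEq ι]

instance (i j : ι) : SigmaFinite (refFactor i j) := by
  unfold refFactor
  split_ifs <;> infer_instance

lemma lmarginal_smul_of_homogeneous {h : (ι → ℝ) → ℝ≥0∞} (hm : Measurable h)
    (hh : ∀ t : ℝ, 0 < t → ∀ x, h (t • x) = h x) (A : Finset ι) {t : ℝ} (ht : 0 < t)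
    (x : ι → ℝ) :
    lmarginal (fun _ => logMeasure) A h (t • x) = lmarginal (fun _ => logMeasure) A h x := by
  have hp : MeasurePreserving (fun (y : A → ℝ) (i : A) => t * y i)
      (Measure.pi fun _ => logMeasure) (Measure.pi fun _ => logMeasure) :=
    measurePreserving_pi _ _ fun _ => measurePreserving_mul_logMeasure ht
  unfold lmarginal
  refine (hp.lintegral_comp (hm.comp measurable_updateFinset)).symm.trans
    (lintegral_congr fun y => ?_)
  rw [← hh t ht (Function.updateFinset x A y)]
  refine congrArg h (funext fun i => ?_)
  by_cases hi : i ∈ A <;> simp [Function.updateFinset, hi]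

lemma lintegral_pi_refFactor [Fintype ι] {h : (ι → ℝ) → ℝ≥0∞} (hm : Measurable h) {i j : ι}
    (hij : i ≠ j) :
    ∫⁻ x, h x ∂Measure.pi (refFactor i) =
      ∫⁻ t, lmarginal (fun _ => logMeasure) ((Finset.univ.erase i).erase j) h
        (Function.update 1 j t) ∂logMeasure := by
  rw [lintegral_eq_lmarginal_univ (1 : ι → ℝ), lmarginal_erase _ hm (Finset.mem_univ i),
    show refFactor i i = Measure.dirac 1 by simp [refFactor], lintegral_dirac' _ (by
      exact (hm.lmarginal _).comp (by fun_prop)),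
    lmarginal_erase _ hm (Finset.mem_erase.2 ⟨hij.symm, Finset.mem_univ j⟩),
    show refFactor i j = logMeasure by simp [refFactor, hij.symm]]
  refine lintegral_congr fun t => ?_
  have h1 : Function.update (1 : ι → ℝ) i 1 = 1 := Function.update_eq_self i (1 : ι → ℝ)
  rw [h1]
  unfold lmarginal
  congr 2
  ext1 k
  have hk : (k : ι) ≠ i := Finset.ne_of_mem_erase (Finset.mem_of_mem_erase k.2)
  simp [refFactor, hk]

lemma lintegral_pi_refFactor_eq_of_homogeneous [Fintype ι] {h : (ι → ℝ) → ℝ≥0∞}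
    (hm : Measurable h) (hh : ∀ t : ℝ, 0 < t → ∀ x, h (t • x) = h x) (i j : ι) :
    ∫⁻ x, h x ∂Measure.pi (refFactor i) = ∫⁻ x, h x ∂Measure.pi (refFactor j) := by
  rcases eq_or_ne i j with rfl | hij
  · rfl
  rw [lintegral_pi_refFactor hm hij, lintegral_pi_refFactor hm hij.symm, Finset.erase_right_comm,
    ← measurePreserving_inv_logMeasure.lintegral_comp (f := fun t =>
      lmarginal (fun _ => logMeasure) ((Finset.univ.erase j).erase i) h (Function.update 1 i t))
      ((hm.lmarginal _).comp (measurable_update _))]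
  refine lintegral_congr_ae (ae_logMeasure_pos.mono fun t ht => ?_)
  dsimp only
  rw [← lmarginal_smul_of_homogeneous hm hh _ (inv_pos.2 ht)]
  refine lmarginal_congr _ _ fun k hk => ?_
  have hk' : k = i ∨ k = j := by
    by_contra hne
    push Not at hne
    exact hk (by simp [hne.1, hne.2])
  rcases hk' with rfl | rfl
  · simp [Function.update_of_ne hij]
  · simp [Function.update_of_ne hij.symm, ht.ne']

end LogMeasure

section Graph

set_option linter.unusedSectionVars false

variable {V : Type*} [Fintype V] [DecidableEq V] (G : SimpleGraph V) [Fintype G.edgeSet]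

lemma rho_eq_pi_refFactor (e₀ : G.edgeSet) : rho G e₀ = Measure.pi (refFactor e₀) := by
  unfold rho refFactor
  rfl

lemma ae_rho_pos (e₀ : G.edgeSet) : ∀ᵐ x ∂rho G e₀, ∀ e, 0 < x e := by
  rw [rho_eq_pi_refFactor, ae_all_iff]
  intro e
  refine (Measure.tendsto_eval_ae_ae (μ := refFactor e₀) (i := e)).eventually ?_
  unfold refFactor
  split_ifs
  · exact (ae_dirac_iff measurableSet_Ioi).2 one_pos
  · exact ae_logMeasure_pos

@[fun_prop]
lemma measurable_vwt (v : V) : Measurable fun x => vwt G x v := by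
  unfold vwt
  refine Finset.measurable_sum _ fun e _ => ?_
  split_ifs <;> fun_prop

lemma measurable_treeSum : Measurable (treeSum G) := by
  unfold treeSum
  refine Finset.measurable_sum _ fun T _ => ?_
  split_ifs <;> fun_prop

@[fun_prop]
lemma measurable_Phi (a : Sym2 V → ℝ) (v : V) : Measurable (Phi G a v) := by
  unfold Phi
  have := measurable_treeSum G
  fun_prop

variable {G}

lemma vwt_pos (hG : G.Connected) (e₀ : G.edgeSet) {x : G.edgeSet → ℝ} (hx : ∀ e, 0 < x e)
    (v : V) : 0 < vwt G x v := by
  obtain ⟨⟨u, w⟩, he⟩ := e₀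
  have : Nontrivial V := ⟨u, w, (show G.Adj u w from he).ne⟩
  obtain ⟨y, hy⟩ := hG.preconnected.exists_adj_of_nontrivial v
  refine Finset.sum_pos' (fun e _ => ?_) ⟨⟨s(v, y), hy⟩, Finset.mem_univ _, ?_⟩
  · split_ifs
    exacts [(hx e).le, le_rfl]
  · simpa using hx _

lemma Phi_nonneg (a : Sym2 V → ℝ) (v : V) {x : G.edgeSet → ℝ} (hx : ∀ e, 0 < x e) :
    0 ≤ Phi G a v x := by
  have hv (w : V) : 0 ≤ vwt G x w := Finset.sum_nonneg fun e _ => by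
    split_ifs
    exacts [(hx e).le, le_rfl]
  exact mul_nonneg (mul_nonneg (mul_nonneg
    (Finset.prod_nonneg fun e _ => Real.rpow_nonneg (hx e).le _) (Real.rpow_nonneg (hv _) _))
    (Finset.prod_nonneg fun w _ => Real.rpow_nonneg (hv w) _)) (Real.sqrt_nonneg _)

lemma Phi_eq_prod (a : Sym2 V → ℝ) (v : V) {x : G.edgeSet → ℝ} (hx : ∀ w, 0 < vwt G x w) :
    Phi G a v x = (∏ e : G.edgeSet, x e ^ a (e : Sym2 V)) *
      (∏ w, vwt G x w ^ (-(avwt G a w + 1) / 2)) * √(treeSum G x) * vwt G x v ^ ((1 : ℝ) / 2) := by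
  rw [Phi, ← Finset.mul_prod_erase _ _ (Finset.mem_univ v),
    show -avwt G a v / 2 = -(avwt G a v + 1) / 2 + 1 / 2 by ring, Real.rpow_add (hx v)]
  ring

lemma Phi_mul_Phi (a : Sym2 V → ℝ) (v₀ v₁ : V) {x : G.edgeSet → ℝ} (hx : ∀ w, 0 < vwt G x w) :
    Phi G a v₀ x * Phi G a v₁ x =
      (Phi G a v₀ x * (vwt G x v₁ / vwt G x v₀) ^ ((1 : ℝ) / 4)) ^ 2 := by
  have h (y : ℝ) (hy : 0 < y) : (y ^ ((1 : ℝ) / 4)) ^ 2 = y ^ ((1 : ℝ) / 2) := by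
    rw [← Real.rpow_natCast, ← Real.rpow_mul hy.le]
    norm_num
  rw [mul_pow, h _ (div_pos (hx _) (hx _)), Real.div_rpow (hx _).le (hx _).le,
    Phi_eq_prod a v₀ hx, Phi_eq_prod a v₁ hx]
  have := (Real.rpow_pos_of_pos (hx v₀) ((1 : ℝ) / 2)).ne'
  field_simp

section Homogeneity

lemma mul_rpow_of_pos {t : ℝ} (ht : 0 < t) (y s : ℝ) : (t * y) ^ s = t ^ s * y ^ s := by
  rcases le_or_gt 0 y with hy | hy
  · exact Real.mul_rpow ht.le hy
  · rw [Real.rpow_def_of_neg (mul_neg_of_pos_of_neg ht hy), Real.rpow_def_of_neg hy,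
      Real.rpow_def_of_pos ht, Real.log_mul ht.ne' hy.ne, add_mul, Real.exp_add, mul_assoc]

lemma vwt_smul (t : ℝ) (x : G.edgeSet → ℝ) (v : V) : vwt G (t • x) v = t * vwt G x v := by
  simp [vwt, Finset.mul_sum]

lemma IsSpanningTree.card_add_one {T : Finset G.edgeSet} (hT : IsSpanningTree G T) :
    T.card + 1 = Fintype.card V := by
  rw [← SimpleGraph.IsTree.card_edgeFinset hT, ← Finset.card_map (Function.Embedding.subtype _)]
  congr 2
  ext e
  simp only [Finset.mem_map, Function.Embedding.subtype_apply, SimpleGraph.mem_edgeFinset,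
    SimpleGraph.edgeSet_fromEdgeSet, Set.mem_sdiff, Set.mem_image, Finset.mem_coe]
  refine ⟨fun h => ⟨h, ?_⟩, fun h => h.1⟩
  obtain ⟨e', -, rfl⟩ := h
  exact G.not_isDiag_of_mem_edgeSet e'.2

lemma treeSum_smul (t : ℝ) (x : G.edgeSet → ℝ) :
    treeSum G (t • x) = t ^ (Fintype.card V - 1) * treeSum G x := by
  simp only [treeSum, Finset.mul_sum]
  refine Finset.sum_congr rfl fun T _ => ?_
  split_ifs with hT
  · simp [Finset.prod_mul_distrib, ← hT.card_add_one]
  · simp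

lemma sum_avwt (a : Sym2 V → ℝ) : ∑ v, avwt G a v = 2 * ∑ e : G.edgeSet, a e := by
  simp only [avwt]
  rw [Finset.sum_comm, Finset.mul_sum]
  refine Finset.sum_congr rfl fun ⟨e, he⟩ _ => ?_
  induction e with | _ u w =>
  have huw : u ≠ w := (show G.Adj u w from he).ne
  have : (Finset.univ.filter fun v => v ∈ s(u, w)) = {u, w} := by
    ext v
    simp
  rw [← Finset.sum_filter, this, Finset.sum_pair huw, two_mul]

lemma Phi_smul (a : Sym2 V → ℝ) (v : V) {t : ℝ} (ht : 0 < t) (x : G.edgeSet → ℝ) :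
    Phi G a v (t • x) = Phi G a v x := by
  have hsqrt : √(t ^ (Fintype.card V - 1)) = t ^ (((Fintype.card V - 1 : ℕ) : ℝ) / 2) := by
    rw [Real.sqrt_eq_rpow, ← Real.rpow_natCast, ← Real.rpow_mul ht.le]
    ring_nf
  have hexp : (∑ e : G.edgeSet, a e) + -avwt G a v / 2 +
      (∑ w ∈ Finset.univ.erase v, -(avwt G a w + 1) / 2) +
      ((Fintype.card V - 1 : ℕ) : ℝ) / 2 = 0 := by
    have h := sum_avwt (G := G) a
    rw [← Finset.add_sum_erase _ _ (Finset.mem_univ v)] at h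
    rw [← Finset.sum_div, Finset.sum_neg_distrib, Finset.sum_add_distrib, Finset.sum_const,
      Finset.card_erase_of_mem (Finset.mem_univ v), Finset.card_univ, nsmul_one]
    linarith
  have hone := Real.rpow_zero t
  rw [← hexp, Real.rpow_add ht, Real.rpow_add ht, Real.rpow_add ht, ← hsqrt,
    Real.rpow_sum_of_pos ht, Real.rpow_sum_of_pos ht] at hone
  simp only [Phi, vwt_smul, treeSum_smul, Pi.smul_apply, smul_eq_mul, mul_rpow_of_pos ht,
    Finset.prod_mul_distrib, Real.sqrt_mul (pow_nonneg ht.le _)]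
  linear_combination ((∏ e : G.edgeSet, x e ^ a (e : Sym2 V)) * vwt G x v ^ (-avwt G a v / 2) *
    (∏ w ∈ Finset.univ.erase v, vwt G x w ^ (-(avwt G a w + 1) / 2)) * √(treeSum G x)) * hone

lemma z_eq_z (a : Sym2 V → ℝ) (v : V) (e₀ e₁ : G.edgeSet) : z G a v e₀ = z G a v e₁ := by
  unfold z
  rw [rho_eq_pi_refFactor, rho_eq_pi_refFactor]
  exact lintegral_pi_refFactor_eq_of_homogeneous (by fun_prop)
    (fun t ht x => by rw [Phi_smul a v ht]) e₀ e₁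

end Homogeneity

section Automorphism

variable (σ : G ≃g G)

lemma mem_mapEdgeSet_iff (e : G.edgeSet) (v : V) :
    σ v ∈ (σ.mapEdgeSet e : Sym2 V) ↔ v ∈ (e : Sym2 V) := by
  change σ v ∈ Sym2.map σ (e : Sym2 V) ↔ _
  simp [Sym2.mem_map]

lemma vwt_apply_iso (x : G.edgeSet → ℝ) (v : V) :
    vwt G x (σ v) = vwt G (x ∘ σ.mapEdgeSet) v := by
  unfold vwt
  rw [← Equiv.sum_comp σ.mapEdgeSet]
  simp only [mem_mapEdgeSet_iff, Function.comp_apply]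

lemma avwt_apply_iso {a : Sym2 V → ℝ} (ha : ∀ e : G.edgeSet, a (σ.mapEdgeSet e) = a e) (v : V) :
    avwt G a (σ v) = avwt G a v := by
  unfold avwt
  rw [← Equiv.sum_comp σ.mapEdgeSet]
  simp only [mem_mapEdgeSet_iff, ha]

lemma isSpanningTree_map_iff (T : Finset G.edgeSet) :
    IsSpanningTree G (T.map σ.mapEdgeSet.toEmbedding) ↔ IsSpanningTree G T := by
  refine (SimpleGraph.Iso.isTree_iff ⟨σ.toEquiv, fun {u w} => ?_⟩).symm
  simp only [SimpleGraph.fromEdgeSet_adj, ne_eq, EmbeddingLike.apply_eq_iff_eq]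
  refine and_congr_left fun _ => ?_
  have hσ (e : G.edgeSet) : (σ.mapEdgeSet e : Sym2 V) = Sym2.map σ e := rfl
  have huw : s(σ.toEquiv u, σ.toEquiv w) = Sym2.map σ s(u, w) := rfl
  simp only [huw, Finset.coe_map, Set.mem_image, exists_exists_and_eq_and,
    Equiv.coe_toEmbedding, hσ, (Sym2.map.injective σ.injective).eq_iff]

lemma treeSum_comp_iso (x : G.edgeSet → ℝ) :
    treeSum G (x ∘ σ.mapEdgeSet) = treeSum G x := by
  unfold treeSum
  conv_rhs => rw [← Equiv.sum_comp σ.mapEdgeSet.finsetCongr]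
  simp only [Equiv.finsetCongr_apply, isSpanningTree_map_iff, Finset.prod_map,
    Equiv.coe_toEmbedding, Function.comp_apply]

lemma Phi_apply_iso {a : Sym2 V → ℝ} (ha : ∀ e : G.edgeSet, a (σ.mapEdgeSet e) = a e) (v : V)
    (x : G.edgeSet → ℝ) : Phi G a (σ v) x = Phi G a v (x ∘ σ.mapEdgeSet) := by
  have herase : Finset.univ.erase (σ v) = (Finset.univ.erase v).map σ.toEquiv.toEmbedding := by
    ext w
    simp [← σ.symm_apply_eq, eq_comm]
  have hE : ∏ e : G.edgeSet, x e ^ a e = ∏ e, x (σ.mapEdgeSet e) ^ a e := by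
    rw [← Equiv.prod_comp σ.mapEdgeSet]
    simp only [ha]
  have hV (w : V) : σ.toEquiv.toEmbedding w = σ w := rfl
  simp only [Phi, herase, Finset.prod_map, hV, vwt_apply_iso, avwt_apply_iso σ ha, hE,
    treeSum_comp_iso, Function.comp_apply]

lemma measurePreserving_comp_iso (e₀ : G.edgeSet) :
    MeasurePreserving (fun x : G.edgeSet → ℝ => x ∘ σ.mapEdgeSet)
      (rho G (σ.mapEdgeSet e₀)) (rho G e₀) := by
  have h := measurePreserving_piCongrLeft (refFactor e₀) σ.mapEdgeSet.symm
  have hμ : (fun e => refFactor e₀ (σ.mapEdgeSet.symm e)) = refFactor (σ.mapEdgeSet e₀) := by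
    ext1 e
    simp only [refFactor, Equiv.symm_apply_eq]
  rw [hμ, ← rho_eq_pi_refFactor, ← rho_eq_pi_refFactor] at h
  convert h using 1
  ext x e
  obtain ⟨e, rfl⟩ := σ.mapEdgeSet.symm.surjective e
  rw [MeasurableEquiv.coe_piCongrLeft, Equiv.piCongrLeft_apply_apply]
  exact congrArg x (σ.mapEdgeSet.apply_symm_apply e)

lemma z_apply_iso {a : Sym2 V → ℝ} (ha : ∀ e : G.edgeSet, a (σ.mapEdgeSet e) = a e) (v : V)
    (e₀ : G.edgeSet) : z G a (σ v) e₀ = z G a v e₀ := by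
  rw [z_eq_z a (σ v) e₀ (σ.mapEdgeSet e₀)]
  unfold z
  rw [← (measurePreserving_comp_iso σ e₀).lintegral_comp (by fun_prop)]
  simp only [Phi_apply_iso σ ha]

end Automorphism

lemma z_eq_z_of_isAut {a : Sym2 V → ℝ} {f : V → V} (hf : IsAut G a f) (v : V)
    (e₀ : G.edgeSet) : z G a (f v) e₀ = z G a v e₀ := by
  obtain ⟨hbij, hadj, ha⟩ := hf
  refine z_apply_iso ⟨Equiv.ofBijective f hbij, hadj _ _⟩ (fun ⟨e, he⟩ => ?_) v e₀
  induction e with | _ u w => exact ha u w he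

lemma interpDens_ae_eq (hG : G.Connected) (a : Sym2 V → ℝ) (v₀ v₁ : V) (e₀ : G.edgeSet)
    (hz : z G a v₁ e₀ = z G a v₀ e₀) :
    interpDens G a v₀ v₁ e₀ =ᵐ[rho G e₀] (z G a v₀ e₀)⁻¹ •
      ((fun x => ENNReal.ofReal (Phi G a v₀ x)) *
        fun x => ENNReal.ofReal ((vwt G x v₁ / vwt G x v₀) ^ ((1 : ℝ) / 4))) := by
  filter_upwards [ae_rho_pos G e₀] with x hx
  have hv := vwt_pos hG e₀ hx
  have hΦ := Phi_nonneg (G := G) a v₀ hx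
  have hr : 0 ≤ (vwt G x v₁ / vwt G x v₀) ^ ((1 : ℝ) / 4) :=
    Real.rpow_nonneg (div_nonneg (hv _).le (hv _).le) _
  have hsq : ENNReal.ofReal (Phi G a v₀ x) / z G a v₀ e₀ *
      (ENNReal.ofReal (Phi G a v₁ x) / z G a v₀ e₀) =
      ((z G a v₀ e₀)⁻¹ * (ENNReal.ofReal (Phi G a v₀ x) *
        ENNReal.ofReal ((vwt G x v₁ / vwt G x v₀) ^ ((1 : ℝ) / 4)))) ^ 2 := by
    rw [← ENNReal.ofReal_mul hΦ, mul_pow, ← ENNReal.ofReal_pow (mul_nonneg hΦ hr),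
      ← Phi_mul_Phi a v₀ v₁ hv, ENNReal.ofReal_mul hΦ, div_eq_mul_inv, div_eq_mul_inv]
    ring
  rw [interpDens, hz, hsq, ← ENNReal.rpow_natCast, ← ENNReal.rpow_mul]
  norm_num

lemma Zc_ne_top (a : Sym2 V → ℝ) (v₀ v₁ : V) (e₀ : G.edgeSet) : Zc G a v₀ v₁ e₀ ≠ ⊤ := by
  have hint (v : V) : ∫⁻ x, ENNReal.ofReal (Phi G a v x) / z G a v e₀ ∂rho G e₀ ≤ 1 := by
    simp_rw [div_eq_mul_inv]
    rw [lintegral_mul_const _ (by fun_prop)]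
    exact ENNReal.div_self_le_one
  have hle (p q : ℝ≥0∞) : (p * q) ^ (1 / 2 : ℝ) ≤ p + q := by
    calc (p * q) ^ (1 / 2 : ℝ) ≤ ((p + q) ^ 2) ^ (1 / 2 : ℝ) := by
          rw [sq]
          gcongr
          exacts [le_self_add, le_add_self]
      _ = p + q := by
          rw [← ENNReal.rpow_natCast, ← ENNReal.rpow_mul]
          norm_num
  refine ne_top_of_le_ne_top (b := 1 + 1) (by simp) ?_
  calc Zc G a v₀ v₁ e₀ ≤ ∫⁻ x, ENNReal.ofReal (Phi G a v₀ x) / z G a v₀ e₀ +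
          ENNReal.ofReal (Phi G a v₁ x) / z G a v₁ e₀ ∂rho G e₀ :=
        lintegral_mono fun x => hle _ _
    _ ≤ 1 + 1 := by
        rw [lintegral_add_left (by fun_prop)]
        exact add_le_add (hint v₀) (hint v₁)

end Graph

end ERRWGraph

open ERRWGraph in
/-- Lemma 4.5: if some automorphism of `(G,a)` swaps `v₀` and `v₁`, the measures
`ℙ_{v₀,v₁,e₀}` and `ℚ_{v₀,e₀}` are mutually absolutely continuous with
`dℙ/dℚ = Z_{v₀,v₁,e₀}^{-1} (x_{v₁}/x_{v₀})^{1/4}`; consequently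
`Z_{v₀,v₁,e₀} = E_{ℚ_{v₀,e₀}}[(x_{v₁}/x_{v₀})^{1/4}]`, which is finite. -/
theorem interp_vs_mixing {V : Type*} [Fintype V] [DecidableEq V]
    (G : SimpleGraph V) [Fintype G.edgeSet] (hG : G.Connected)
    (a : Sym2 V → ℝ) (ha : ∀ e ∈ G.edgeSet, 0 < a e) (v₀ v₁ : V)
    (hf : ∃ f : V → V, IsAut G a f ∧ f v₀ = v₁ ∧ f v₁ = v₀)
    (e₀ : G.edgeSet)
    (hz0 : z G a v₀ e₀ ≠ ⊤) (hz1 : z G a v₁ e₀ ≠ ⊤) :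
    Pm G a v₀ v₁ e₀ ≪ Qm G a v₀ e₀ ∧ Qm G a v₀ e₀ ≪ Pm G a v₀ v₁ e₀ ∧
    Pm G a v₀ v₁ e₀ = (Qm G a v₀ e₀).withDensity
      (fun x => ENNReal.ofReal ((vwt G x v₁ / vwt G x v₀) ^ ((1 : ℝ) / 4)) /
        Zc G a v₀ v₁ e₀) ∧
    Zc G a v₀ v₁ e₀ =
      (∫⁻ x, ENNReal.ofReal ((vwt G x v₁ / vwt G x v₀) ^ ((1 : ℝ) / 4)) ∂Qm G a v₀ e₀) ∧
    Zc G a v₀ v₁ e₀ ≠ ⊤ := by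
  obtain ⟨f, hf, hf₀, -⟩ := hf
  have hz : z G a v₁ e₀ = z G a v₀ e₀ := hf₀ ▸ z_eq_z_of_isAut hf v₀ e₀
  have hdens := interpDens_ae_eq hG a v₀ v₁ e₀ hz
  have hZ := Zc_ne_top a v₀ v₁ e₀
  set φ : (G.edgeSet → ℝ) → ℝ≥0∞ := fun x => ENNReal.ofReal (Phi G a v₀ x)
  set r : (G.edgeSet → ℝ) → ℝ≥0∞ :=
    fun x => ENNReal.ofReal ((vwt G x v₁ / vwt G x v₀) ^ ((1 : ℝ) / 4))
  have hφ : Measurable φ := by fun_prop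
  have hr : Measurable r := by fun_prop
  have hQ : Qm G a v₀ e₀ = (z G a v₀ e₀)⁻¹ • (rho G e₀).withDensity φ := rfl
  have hP : Pm G a v₀ v₁ e₀ =
      (Qm G a v₀ e₀).withDensity (fun x => r x / Zc G a v₀ v₁ e₀) := by
    have hdiv : (fun x => r x / Zc G a v₀ v₁ e₀) = (Zc G a v₀ v₁ e₀)⁻¹ • r := by
      ext x
      simp [div_eq_mul_inv, mul_comm]
    rw [hdiv, withDensity_smul _ hr, hQ, withDensity_smul_measure, ← withDensity_mul _ hφ hr,
      ← withDensity_smul _ (hφ.mul hr), Pm, withDensity_congr_ae hdens]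
  have hpos : ∀ᵐ x ∂Qm G a v₀ e₀, r x / Zc G a v₀ v₁ e₀ ≠ 0 := by
    have hac : Qm G a v₀ e₀ ≪ rho G e₀ :=
      Measure.smul_absolutelyContinuous.trans (withDensity_absolutelyContinuous _ _)
    filter_upwards [hac.ae_le (ae_rho_pos G e₀)] with x hx
    have hv := vwt_pos hG e₀ hx
    exact ENNReal.div_ne_zero.2
      ⟨(ENNReal.ofReal_pos.2 (Real.rpow_pos_of_pos (div_pos (hv _) (hv _)) _)).ne', hZ⟩
  refine ⟨hP ▸ withDensity_absolutelyContinuous _ _,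
    hP ▸ withDensity_absolutelyContinuous' (by fun_prop) hpos, hP, ?_, hZ⟩
  rw [hQ, lintegral_smul_measure, lintegral_withDensity_eq_lintegral_mul _ hφ hr, Zc,
    lintegral_congr_ae hdens, smul_eq_mul, ← lintegral_const_mul _ (hφ.mul hr)]
  rfl
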